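/- arXiv:2012.02701 — 2 statements merged into one kernel-verified Lean document; each statement's English description precedes it below -/
import Mathlib

section
/- Let G be a finite simple graph, let c > 0 be a real number such that G has 1-shallow-minor density at most c, let k ≥ 2 be an integer with k ≥ 2c, and set α = 1/k, ℓ = 4k³ + 1, q = 4k⁴. Then for every vertex v with |N(v)| > ℓ, the number of distinct pseudo-covers of N(v) (with parameters (α, ℓ, q, k)) is at most 2·(2k²)^k, and the set 𝒫(v) of vertices appearing in some pseudo-cover of N(v) satisfies |𝒫(v)| ≤ 2k·(2k²)^k ≤ (2k)^{2k+1}. -/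
open Finset

variable {V : Type*}

/-- The closed neighborhood `N[v]` of a vertex as a `Finset`. -/
def closedNbhd [Fintype V] [DecidableEq V] (G : SimpleGraph V) [DecidableRel G.Adj]
    (v : V) : Finset V :=
  insert v (G.neighborFinset v)

/-- `H` (on vertex set `Fin n`) is a 1-shallow minor of `G`: there are pairwise disjoint
branch sets, each inducing a connected subgraph of radius at most 1 (i.e. having a center
adjacent to all its other vertices), such that edges of `H` are realized by edges of `G`
between the corresponding branch sets. -/
def IsOneShallowMinor (G : SimpleGraph V) {n : ℕ} (H : SimpleGraph (Fin n)) : Prop :=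
  ∃ B : Fin n → Finset V,
    (∀ i, ∃ c ∈ B i, ∀ w ∈ B i, w = c ∨ G.Adj c w) ∧
    (∀ i j, i ≠ j → Disjoint (B i) (B j)) ∧
    (∀ i j, H.Adj i j → ∃ a ∈ B i, ∃ b ∈ B j, G.Adj a b)

/-- `G` has 1-shallow-minor density at most `c`: every 1-shallow minor `H` of `G`
satisfies `|E(H)| ≤ c * |V(H)|`. -/
def DensityOneLE (G : SimpleGraph V) (c : ℝ) : Prop :=
  ∀ (n : ℕ) (H : SimpleGraph (Fin n)), IsOneShallowMinor G H →
    (Nat.card H.edgeSet : ℝ) ≤ c * n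

/-- The list `L = (v₁, …, vₘ)` is a pseudo-cover of `W` with parameters `(α, ℓ, q, k)`. -/
def PseudoCover [Fintype V] [DecidableEq V] (G : SimpleGraph V) [DecidableRel G.Adj]
    (α : ℝ) (ℓ q k : ℕ) (W : Finset V) (L : List V) : Prop :=
  L.length ≤ k ∧
  (W \ (L.toFinset.biUnion (closedNbhd G))).card ≤ q ∧
  ∀ i (hi : i < L.length),
    α * (((W \ ((L.take i).toFinset.biUnion (closedNbhd G))).card : ℝ)) ≤
      (((closedNbhd G (L.get ⟨i, hi⟩)) ∩
        (W \ ((L.take i).toFinset.biUnion (closedNbhd G)))).card : ℝ) ∧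
    ℓ ≤ ((closedNbhd G (L.get ⟨i, hi⟩)) ∩
        (W \ ((L.take i).toFinset.biUnion (closedNbhd G)))).card

/-- `𝒫(v)`: the set of vertices appearing in some pseudo-cover of `N(v)`,
when `|N(v)| > ℓ`, and `∅` otherwise. -/
def PCov [Fintype V] [DecidableEq V] (G : SimpleGraph V) [DecidableRel G.Adj]
    (α : ℝ) (ℓ q k : ℕ) (v : V) : Set V :=
  {u | ℓ < (G.neighborFinset v).card ∧
    ∃ L : List V, PseudoCover G α ℓ q k (G.neighborFinset v) L ∧ u ∈ L}

/-- In a graph of bounded 1-shallow-minor density there are few edges between two disjoint sets. -/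
theorem card_adj_pairs_le_of_densityOneLE [DecidableEq V] {G : SimpleGraph V}
    [DecidableRel G.Adj] {c : ℝ} (hdens : DensityOneLE G c) {A B : Finset V}
    (hAB : Disjoint A B) :
    (#{p ∈ A ×ˢ B | G.Adj p.1 p.2} : ℝ) ≤ c * (#A + #B : ℕ) := by
  rw [← card_union_of_disjoint hAB]
  set S := A ∪ B
  let e : S ≃ Fin #S := S.equivFin
  let H : SimpleGraph (Fin #S) := G.comap fun i => ((e.symm i : S) : V)
  have hminor : IsOneShallowMinor G H := by
    refine ⟨fun i => {((e.symm i : S) : V)}, fun i => ⟨_, mem_singleton_self _, ?_⟩, ?_, ?_⟩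
    · intro w hw
      exact Or.inl (mem_singleton.1 hw)
    · intro i j hij
      rw [disjoint_singleton]
      exact fun h => hij (e.symm.injective (Subtype.ext h))
    · intro i j hij
      exact ⟨_, mem_singleton_self _, _, mem_singleton_self _, hij⟩
  refine le_trans ?_ (hdens _ H hminor)
  have hmem : ∀ p ∈ ({p ∈ A ×ˢ B | G.Adj p.1 p.2} : Finset (V × V)),
      p.1 ∈ A ∧ p.2 ∈ B ∧ G.Adj p.1 p.2 := by
    intro p hp
    simpa [and_assoc] using hp
  have hA : ∀ p ∈ ({p ∈ A ×ˢ B | G.Adj p.1 p.2} : Finset (V × V)), p.1 ∈ S := fun p hp =>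
    mem_union_left _ (hmem p hp).1
  have hB : ∀ p ∈ ({p ∈ A ×ˢ B | G.Adj p.1 p.2} : Finset (V × V)), p.2 ∈ S := fun p hp =>
    mem_union_right _ (hmem p hp).2.1
  let f : ({p ∈ A ×ˢ B | G.Adj p.1 p.2} : Finset (V × V)) → H.edgeSet := fun p =>
    ⟨s(e ⟨p.1.1, hA p.1 p.2⟩, e ⟨p.1.2, hB p.1 p.2⟩), by
      simpa [H] using (hmem p.1 p.2).2.2⟩
  have hf : Function.Injective f := by
    rintro ⟨p, hp⟩ ⟨r, hr⟩ h
    have h' := congrArg Subtype.val h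
    simp only [f, Sym2.eq_iff, EmbeddingLike.apply_eq_iff_eq, Subtype.mk.injEq] at h'
    rcases h' with ⟨h1, h2⟩ | ⟨h1, -⟩
    · exact Subtype.ext (Prod.ext h1 h2)
    · exact absurd (h1 ▸ (hmem p hp).1) (disjoint_right.1 hAB (hmem r hr).2.1)
  have := Nat.card_le_card_of_injective f hf
  rw [Nat.card_eq_fintype_card, Fintype.card_coe] at this
  exact_mod_cast this

/-- In a graph of bounded 1-shallow-minor density, a large set has few strong vertices. -/
theorem card_strong_le [Fintype V] [DecidableEq V] {G : SimpleGraph V} [DecidableRel G.Adj]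
    {c : ℝ} (hdens : DensityOneLE G c) {k : ℕ} (hk : 2 ≤ k) (hkc : 2 * c ≤ (k : ℝ))
    {W Z : Finset V} (hW : 4 * k ^ 3 + 1 ≤ #W)
    (hZ : ∀ z ∈ Z, 1 / (k : ℝ) * #W ≤ #(closedNbhd G z ∩ W)) :
    #Z ≤ 2 * k ^ 2 := by
  by_contra! hlt
  obtain ⟨Y, hYZ, hY⟩ := exists_subset_card_eq (Nat.succ_le_of_lt hlt)
  have hupper := card_adj_pairs_le_of_densityOneLE hdens (disjoint_sdiff (s := Y) (t := W))
  have hpairs : #{p ∈ Y ×ˢ (W \ Y) | G.Adj p.1 p.2} = ∑ y ∈ Y, #{w ∈ W \ Y | G.Adj y w} := by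
    simp only [card_filter, sum_product]
  have hdeg : ∀ y ∈ Y, 1 / (k : ℝ) * #W - #Y ≤ #{w ∈ W \ Y | G.Adj y w} := by
    intro y hy
    have hsub : closedNbhd G y ∩ W ⊆ {w ∈ W \ Y | G.Adj y w} ∪ Y := by
      intro w hw
      simp only [closedNbhd, mem_inter, mem_insert, SimpleGraph.mem_neighborFinset] at hw
      simp only [mem_union, mem_filter, mem_sdiff]
      by_cases hwY : w ∈ Y
      · exact Or.inr hwY
      · rcases hw.1 with rfl | h
        · exact absurd hy hwY
        · exact Or.inl ⟨⟨hw.2, hwY⟩, h⟩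
    have hcard : (#(closedNbhd G y ∩ W) : ℝ) ≤ #{w ∈ W \ Y | G.Adj y w} + #Y := by
      exact_mod_cast (card_le_card hsub).trans (card_union_le _ _)
    linarith [hZ y (hYZ hy)]
  have hlower : (#Y : ℝ) * (1 / (k : ℝ) * #W - #Y) ≤ c * (#Y + #(W \ Y) : ℕ) := by
    refine le_trans ?_ hupper
    rw [hpairs, Nat.cast_sum, ← nsmul_eq_mul]
    exact card_nsmul_le_sum _ _ _ hdeg
  have hYr : (#Y : ℝ) = 2 * (k : ℝ) ^ 2 + 1 := by
    rw [hY]; push_cast; ring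
  have hWr : 4 * (k : ℝ) ^ 3 + 1 ≤ #W := by exact_mod_cast hW
  have hkr : (2 : ℝ) ≤ k := by exact_mod_cast hk
  have hsize : ((#Y + #(W \ Y) : ℕ) : ℝ) ≤ 2 * (k : ℝ) ^ 2 + 1 + #W := by
    rw [Nat.cast_add, hYr]
    have : (#(W \ Y) : ℝ) ≤ #W := by exact_mod_cast card_le_card sdiff_subset
    linarith
  have hc : c * (#Y + #(W \ Y) : ℕ) ≤ (k : ℝ) / 2 * (2 * (k : ℝ) ^ 2 + 1 + #W) :=
    mul_le_mul (by linarith) hsize (Nat.cast_nonneg _) (by positivity)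
  have hmain := hlower.trans hc
  rw [hYr] at hmain
  generalize (#W : ℝ) = w at hmain hWr
  generalize (k : ℝ) = x at hmain hWr hkr
  have hx : 0 < x := by linarith
  have hexp : (2 * x ^ 2 + 1) * (1 / x * w - (2 * x ^ 2 + 1)) =
      2 * x * w + w / x - (2 * x ^ 2 + 1) ^ 2 := by
    field_simp
  have hxw : x * (4 * x ^ 3 + 1) ≤ x * w := mul_le_mul_of_nonneg_left hWr hx.le
  have hwx' : 4 * x ^ 2 ≤ w / x := by
    rw [le_div_iff₀ hx]
    nlinarith
  have h3 : 0 ≤ (x - 2) * x ^ 3 := mul_nonneg (by linarith) (by positivity)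
  have h4 : 0 < x ^ 3 := by positivity
  nlinarith

/-- Lists of a given length all of whose entries are chosen, given the preceding ones,
from at most `D` possibilities. -/
theorem exists_finset_lists_card_le_pow [Fintype V] [DecidableEq V] {P : List V → V → Prop}
    {D : ℕ} (hD : ∀ (L : List V) (Z : Finset V), (∀ z ∈ Z, P L z) → #Z ≤ D) (m : ℕ) :
    ∃ T : Finset (List V), #T ≤ D ^ m ∧
      ∀ L : List V, L.length = m → (∀ i (hi : i < L.length), P (L.take i) L[i]) → L ∈ T := by
  classical
  induction m with
  | zero => exact ⟨{[]}, by simp, fun L hL _ => by simp [List.length_eq_zero_iff.1 hL]⟩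
  | succ m ih =>
    obtain ⟨T, hT, hmem⟩ := ih
    refine ⟨T.biUnion fun L => (univ.filter (P L)).image fun x => L ++ [x], ?_, ?_⟩
    · rw [pow_succ]
      refine (card_biUnion_le_card_mul _ _ D fun L _ => card_image_le.trans ?_).trans
        (Nat.mul_le_mul_right _ hT)
      exact hD L _ fun z hz => (mem_filter.1 hz).2
    · intro L hL hP
      obtain rfl | ⟨M, x, rfl⟩ := L.eq_nil_or_concat
      · simp at hL
      simp only [List.concat_eq_append] at hL hP ⊢
      have hM : M.length = m := by simpa using hL
      have hlast := hP m (by simp [hM])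
      simp only [mem_biUnion, mem_image, mem_filter, mem_univ, true_and]
      refine ⟨M, hmem M hM fun i hi => ?_, x, ?_, rfl⟩
      · have := hP i (by simp; omega)
        rwa [List.take_append_of_le_length hi.le, List.getElem_append_left hi] at this
      · subst hM
        simpa using hlast

theorem sum_range_succ_pow_le_two_mul_pow {D : ℕ} (hD : 2 ≤ D) (k : ℕ) :
    ∑ m ∈ range (k + 1), D ^ m ≤ 2 * D ^ k := by
  induction k with
  | zero => simp
  | succ k ih =>
    rw [sum_range_succ, pow_succ]
    nlinarith [Nat.mul_le_mul_left (D ^ k) hD]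

/-- Lists of length at most `k` all of whose entries are chosen, given the preceding ones,
from at most `D` possibilities. -/
theorem exists_finset_lists_card_le_two_mul_pow [Fintype V] [DecidableEq V]
    {P : List V → V → Prop} {D : ℕ} (h2 : 2 ≤ D)
    (hD : ∀ (L : List V) (Z : Finset V), (∀ z ∈ Z, P L z) → #Z ≤ D) (k : ℕ) :
    ∃ T : Finset (List V), #T ≤ 2 * D ^ k ∧
      ∀ L : List V, L.length ≤ k → (∀ i (hi : i < L.length), P (L.take i) L[i]) → L ∈ T := by
  choose T hT hmem using exists_finset_lists_card_le_pow hD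
  refine ⟨(range (k + 1)).biUnion T, ?_, fun L hL hP => ?_⟩
  · exact card_biUnion_le.trans <| (sum_le_sum fun m _ => hT m).trans
      (sum_range_succ_pow_le_two_mul_pow h2 k)
  · exact mem_biUnion.2 ⟨L.length, mem_range.2 (by omega), hmem _ L rfl hP⟩

/-- if `G` has 1-shallow-minor density at most `c > 0`, `k ≥ 2`, `k ≥ 2c`,
then for every vertex `v` with `|N(v)| > ℓ = 4k³+1` the number of pseudo-covers of `N(v)`
is at most `2·(2k²)^k`, and `|𝒫(v)| ≤ 2k·(2k²)^k ≤ (2k)^(2k+1)`. -/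
theorem stmt5 [Fintype V] [DecidableEq V] (G : SimpleGraph V) [DecidableRel G.Adj]
    (c : ℝ) (hc : 0 < c) (hdens : DensityOneLE G c)
    (k : ℕ) (hk : 2 ≤ k) (hkc : 2 * c ≤ (k : ℝ))
    (v : V) (hv : 4 * k ^ 3 + 1 < (G.neighborFinset v).card) :
    ({L : List V | PseudoCover G (1 / (k : ℝ)) (4 * k ^ 3 + 1) (4 * k ^ 4) k
        (G.neighborFinset v) L}.Finite ∧
      {L : List V | PseudoCover G (1 / (k : ℝ)) (4 * k ^ 3 + 1) (4 * k ^ 4) k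
        (G.neighborFinset v) L}.ncard ≤ 2 * (2 * k ^ 2) ^ k) ∧
    (PCov G (1 / (k : ℝ)) (4 * k ^ 3 + 1) (4 * k ^ 4) k v).ncard ≤ 2 * k * (2 * k ^ 2) ^ k ∧
    2 * k * (2 * k ^ 2) ^ k ≤ (2 * k) ^ (2 * k + 1) := by
  set S := {L : List V | PseudoCover G (1 / (k : ℝ)) (4 * k ^ 3 + 1) (4 * k ^ 4) k
    (G.neighborFinset v) L}
  obtain ⟨T, hT, hmem⟩ := exists_finset_lists_card_le_two_mul_pow (D := 2 * k ^ 2)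
    (P := fun L z =>
      1 / (k : ℝ) * #(G.neighborFinset v \ L.toFinset.biUnion (closedNbhd G)) ≤
        #(closedNbhd G z ∩ (G.neighborFinset v \ L.toFinset.biUnion (closedNbhd G))) ∧
      4 * k ^ 3 + 1 ≤
        #(closedNbhd G z ∩ (G.neighborFinset v \ L.toFinset.biUnion (closedNbhd G))))
    (by nlinarith)
    (fun L Z hZ => by
      obtain rfl | ⟨z, hz⟩ := Z.eq_empty_or_nonempty
      · simp
      · exact card_strong_le hdens hk hkc
          ((hZ z hz).2.trans (card_le_card inter_subset_right)) fun z hz => (hZ z hz).1) k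
  have hST : S ⊆ T := fun L hL => hmem L hL.1 hL.2.2
  have hfin : S.Finite := T.finite_toSet.subset hST
  have hcard : S.ncard ≤ 2 * (2 * k ^ 2) ^ k :=
    (Set.ncard_le_ncard hST T.finite_toSet).trans (by rwa [Set.ncard_coe_finset])
  refine ⟨⟨hfin, hcard⟩, ?_, ?_⟩
  · have hsub : PCov G (1 / (k : ℝ)) (4 * k ^ 3 + 1) (4 * k ^ 4) k v ⊆
        (hfin.toFinset.biUnion List.toFinset : Finset V) := by
      rintro u ⟨-, L, hL, hu⟩
      exact mem_coe.2 (mem_biUnion.2 ⟨L, hfin.mem_toFinset.2 hL, List.mem_toFinset.2 hu⟩)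
    have hle := Set.ncard_le_ncard hsub (finite_toSet _)
    rw [Set.ncard_coe_finset] at hle
    have hle' := card_biUnion_le_card_mul hfin.toFinset List.toFinset k fun L hL =>
      L.toFinset_card_le.trans (hfin.mem_toFinset.1 hL).1
    rw [← Set.ncard_eq_toFinset_card S hfin] at hle'
    calc _ ≤ S.ncard * k := hle.trans hle'
      _ ≤ 2 * (2 * k ^ 2) ^ k * k := Nat.mul_le_mul_right _ hcard
      _ = _ := by ring
  · rw [pow_succ (2 * k) (2 * k), pow_mul, mul_comm]
    exact Nat.mul_le_mul_right _ (Nat.pow_le_pow_left (by nlinarith) _)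
end

section
/- Let G be a finite simple graph, let t ≥ 1 and k ≥ 2 be integers such that G contains no K_{t,t} subgraph, set α = 1/k, ℓ = 4k³ + 1, q = 4k⁴, and let D' ⊆ V(G) have the k-cover property. Then every maximal k-dominating-sequence (v_1,…,v_s) of any vertex v satisfies s < t and {v_1,…,v_s} ∩ D' ≠ ∅. -/
open Finset

variable {V : Type*}

/-- `G` contains `K_{t,t}` as a subgraph. -/
def HasKtt (G : SimpleGraph V) (t : ℕ) : Prop :=
  ∃ A B : Finset V, Disjoint A B ∧ A.card = t ∧ B.card = t ∧
    ∀ a ∈ A, ∀ b ∈ B, G.Adj a b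

/-- `D'` has the `k`-cover property: for every vertex `v` there is `Z ⊆ D' \\ {v}`
with `|Z| ≤ k` and `N(v) ⊆ N[Z]`. -/
def KCoverProp [Fintype V] [DecidableEq V] (G : SimpleGraph V) [DecidableRel G.Adj]
    (D' : Finset V) (k : ℕ) : Prop :=
  ∀ v : V, ∃ Z : Finset V, Z ⊆ D'.erase v ∧ Z.card ≤ k ∧
    G.neighborFinset v ⊆ Z.biUnion (closedNbhd G)

/-- `(vs 1, …, vs s)` is a `k`-dominating-sequence of `v` (with parameters
`α, ℓ, q, k, t`): the vertices are pairwise distinct, `vs 1 = v`, and there are sets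
`B 1, …, B s` with `B 1 ⊆ N(vs 1)`, `B i ⊆ N(vs i) ∩ B (i-1)`,
`|B i| ≥ k^(t-i) * (2t - i + (t-i)q)` and `vs i ∈ 𝒫(vs (i-1))`. -/
def KDomSeq [Fintype V] [DecidableEq V] (G : SimpleGraph V) [DecidableRel G.Adj]
    (α : ℝ) (ℓ q k t : ℕ) (v : V) (s : ℕ) (vs : ℕ → V) : Prop :=
  1 ≤ s ∧ vs 1 = v ∧
  (∀ i j, 1 ≤ i → i < j → j ≤ s → vs i ≠ vs j) ∧
  ∃ B : ℕ → Finset V,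
    B 1 ⊆ G.neighborFinset (vs 1) ∧
    (∀ i, 2 ≤ i → i ≤ s → B i ⊆ G.neighborFinset (vs i) ∩ B (i - 1)) ∧
    (∀ i, 1 ≤ i → i ≤ s → k ^ (t - i) * (2 * t - i + (t - i) * q) ≤ (B i).card) ∧
    (∀ i, 2 ≤ i → i ≤ s → vs i ∈ PCov G α ℓ q k (vs (i - 1)))

/-- A maximal `k`-dominating-sequence: one that cannot be extended by any vertex. -/
def MaxKDomSeq [Fintype V] [DecidableEq V] (G : SimpleGraph V) [DecidableRel G.Adj]
    (α : ℝ) (ℓ q k t : ℕ) (v : V) (s : ℕ) (vs : ℕ → V) : Prop :=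
  KDomSeq G α ℓ q k t v s vs ∧
  ¬ ∃ u : V, KDomSeq G α ℓ q k t v (s + 1) (Function.update vs (s + 1) u)

theorem PseudoCover.cons [Fintype V] [DecidableEq V] {G : SimpleGraph V} [DecidableRel G.Adj]
    {α : ℝ} {ℓ q k : ℕ} {W : Finset V} {z : V} {L : List V}
    (hL : PseudoCover G α ℓ q k (W \ closedNbhd G z) L)
    (hα : α * (W.card : ℝ) ≤ ((closedNbhd G z ∩ W).card : ℝ))
    (hℓ : ℓ ≤ (closedNbhd G z ∩ W).card) :
    PseudoCover G α ℓ q (k + 1) W (z :: L) := by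
  have key : ∀ M : List V, W \ ((z :: M).toFinset.biUnion (closedNbhd G)) =
      (W \ closedNbhd G z) \ (M.toFinset.biUnion (closedNbhd G)) := by
    intro M
    rw [List.toFinset_cons, Finset.biUnion_insert, sdiff_sdiff_left]
    rfl
  obtain ⟨h1, h2, h3⟩ := hL
  refine ⟨by simpa using h1, by rwa [key], ?_⟩
  rintro (_ | i) hi
  · simpa using ⟨hα, hℓ⟩
  · have := h3 i (by simpa using hi)
    rw [List.take_succ_cons, key]
    simpa using this

theorem PseudoCover.mono_length [Fintype V] [DecidableEq V] {G : SimpleGraph V}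
    [DecidableRel G.Adj] {α : ℝ} {ℓ q k k' : ℕ} {W : Finset V} {L : List V}
    (hL : PseudoCover G α ℓ q k W L) (h : k ≤ k') : PseudoCover G α ℓ q k' W L :=
  ⟨hL.1.trans h, hL.2⟩

/-- The greedy choice of vertices from a set `Z` covering `W` yields a pseudo-cover of `W`. -/
theorem exists_pseudoCover_of_subset_biUnion [Fintype V] [DecidableEq V] (G : SimpleGraph V)
    [DecidableRel G.Adj] (k c : ℕ) (hk : 0 < k) (m : ℕ) (hm : m ≤ k) (Z W : Finset V)
    (hZ : Z.card = m) (hW : W ⊆ Z.biUnion (closedNbhd G)) :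
    ∃ L : List V, (∀ x ∈ L, x ∈ Z) ∧ PseudoCover G (1 / (k : ℝ)) (c + 1) (k * c) m W L := by
  induction m generalizing Z W with
  | zero =>
    obtain rfl := Finset.card_eq_zero.mp hZ
    obtain rfl : W = ∅ := by simpa using hW
    exact ⟨[], by simp, by simp [PseudoCover]⟩
  | succ m ih =>
    have hcard : W.card ≤ ∑ z ∈ Z, (closedNbhd G z ∩ W).card := by
      refine le_trans (Finset.card_le_card ?_) Finset.card_biUnion_le
      intro w hw
      obtain ⟨z, hz, hwz⟩ := Finset.mem_biUnion.mp (hW hw)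
      exact Finset.mem_biUnion.mpr ⟨z, hz, Finset.mem_inter.mpr ⟨hwz, hw⟩⟩
    obtain ⟨z, hz, hmax⟩ := Finset.exists_max_image Z (fun z => (closedNbhd G z ∩ W).card)
      (Finset.card_pos.mp (by omega))
    have hle : W.card ≤ k * (closedNbhd G z ∩ W).card := by
      refine hcard.trans ((Finset.sum_le_card_nsmul _ _ _ hmax).trans ?_)
      rw [smul_eq_mul]
      exact Nat.mul_le_mul_right _ (by omega)
    by_cases hc : c + 1 ≤ (closedNbhd G z ∩ W).card
    · obtain ⟨L, hLZ, hL⟩ := ih (by omega) (Z.erase z) (W \ closedNbhd G z)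
        (by rw [Finset.card_erase_of_mem hz, hZ]; rfl) (by
          intro w hw
          obtain ⟨hwW, hwz⟩ := Finset.mem_sdiff.mp hw
          obtain ⟨y, hy, hwy⟩ := Finset.mem_biUnion.mp (hW hwW)
          refine Finset.mem_biUnion.mpr ⟨y, Finset.mem_erase.mpr ⟨?_, hy⟩, hwy⟩
          rintro rfl
          exact hwz hwy)
      refine ⟨z :: L, ?_, hL.cons ?_ hc⟩
      · intro x hx
        rcases List.mem_cons.mp hx with rfl | hx
        · exact hz
        · exact Finset.mem_of_mem_erase (hLZ x hx)
      · have hk' : (0 : ℝ) < k := by exact_mod_cast hk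
        rw [one_div, inv_mul_le_iff₀ hk']
        exact_mod_cast hle
    · refine ⟨[], by simp, by simp, ?_, by simp⟩
      simpa using hle.trans (Nat.mul_le_mul_left k (by omega : _ ≤ c))

/-- If at most `q` vertices of `B` escape the closed neighborhoods of the at most `k` vertices
of `L`, then some vertex of `L` is adjacent to a proportional part of `B`. -/
theorem exists_mem_card_le_neighborFinset_inter [Fintype V] [DecidableEq V] (G : SimpleGraph V)
    [DecidableRel G.Adj] {k q n : ℕ} {B : Finset V} {L : List V} (hlen : L.length ≤ k)
    (hq : (B \ L.toFinset.biUnion (closedNbhd G)).card ≤ q) (hn : k * n + q < B.card) :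
    ∃ u ∈ L, n ≤ (G.neighborFinset u ∩ B).card := by
  by_contra! hcon
  have hB : B ⊆ (B \ L.toFinset.biUnion (closedNbhd G)) ∪
      L.toFinset.biUnion (fun u => closedNbhd G u ∩ B) := by
    intro b hb
    simp only [Finset.mem_union, Finset.mem_sdiff, Finset.mem_biUnion, Finset.mem_inter]
    grind
  have hsum : (L.toFinset.biUnion (fun u => closedNbhd G u ∩ B)).card ≤ L.toFinset.card * n := by
    refine Finset.card_biUnion_le_card_mul _ _ _ fun u hu => ?_
    have h1 := hcon u (List.mem_toFinset.mp hu)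
    have h2 : (closedNbhd G u ∩ B).card ≤ (insert u (G.neighborFinset u ∩ B)).card := by
      refine Finset.card_le_card fun x hx => ?_
      simp only [closedNbhd, Finset.mem_inter, Finset.mem_insert] at hx ⊢
      tauto
    have h3 := Finset.card_insert_le u (G.neighborFinset u ∩ B)
    omega
  have h4 : L.toFinset.card * n ≤ k * n :=
    Nat.mul_le_mul_right _ ((List.toFinset_card_le L).trans hlen)
  have h5 := (Finset.card_le_card hB).trans (Finset.card_union_le _ _)
  omega

theorem KDomSeq.lt_of_not_hasKtt [Fintype V] [DecidableEq V] {G : SimpleGraph V}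
    [DecidableRel G.Adj] {α : ℝ} {ℓ q k t : ℕ} {v : V} {s : ℕ} {vs : ℕ → V} (ht : 1 ≤ t)
    (h : KDomSeq G α ℓ q k t v s vs) (hKtt : ¬ HasKtt G t) : s < t := by
  by_contra! hts
  obtain ⟨-, -, hinj, B, hB1, hBsub, hBcard, -⟩ := h
  have hsub : ∀ j, 1 ≤ j → j ≤ s → ∀ i, 1 ≤ i → i ≤ j → B j ⊆ G.neighborFinset (vs i) := by
    intro j hj
    induction j, hj using Nat.le_induction with
    | base =>
      intro _ i hi hij
      obtain rfl : i = 1 := by omega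
      exact hB1
    | succ j hj ih =>
      intro hjs i hi hij
      have hstep := hBsub (j + 1) (by omega) hjs
      rcases Nat.lt_or_ge j i with hji | hji
      · obtain rfl : i = j + 1 := by omega
        exact hstep.trans Finset.inter_subset_left
      · exact (hstep.trans Finset.inter_subset_right).trans (ih (by omega) i hi hji)
  have hcard : t ≤ (B t).card := by
    have := hBcard t ht hts
    simp only [Nat.sub_self, pow_zero, one_mul, Nat.zero_mul] at this
    omega
  obtain ⟨C, hCB, hC⟩ := Finset.exists_subset_card_eq hcard
  have hadj : ∀ a ∈ (Finset.Icc 1 t).image vs, ∀ b ∈ C, G.Adj a b := by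
    intro a ha b hb
    obtain ⟨i, hi, rfl⟩ := Finset.mem_image.mp ha
    rw [Finset.mem_Icc] at hi
    exact (G.mem_neighborFinset _ _).mp (hsub t ht hts i hi.1 hi.2 (hCB hb))
  refine hKtt ⟨(Finset.Icc 1 t).image vs, C, ?_, ?_, hC, hadj⟩
  · rw [Finset.disjoint_left]
    exact fun a ha hac => G.loopless.irrefl a (hadj a ha a hac)
  · rw [Finset.card_image_of_injOn]
    · simp
    · intro i hi j hj hij
      simp only [Finset.coe_Icc, Set.mem_Icc] at hi hj
      rcases lt_trichotomy i j with h | h | h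
      · exact absurd hij (hinj i j hi.1 h (by omega))
      · exact h
      · exact absurd hij.symm (hinj j i hj.1 h (by omega))

theorem kDomSeq_extend_bound {k q t s : ℕ} (hk : 2 ≤ k) (hs : s < t) :
    k * (k ^ (t - (s + 1)) * (2 * t - (s + 1) + (t - (s + 1)) * q)) + q <
      k ^ (t - s) * (2 * t - s + (t - s) * q) := by
  obtain ⟨d, rfl⟩ := Nat.exists_eq_add_of_lt hs
  have e1 : s + d + 1 - (s + 1) = d := by omega
  have e2 : s + d + 1 - s = d + 1 := by omega
  have e3 : 2 * (s + d + 1) - (s + 1) = s + 2 * d + 1 := by omega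
  have e4 : 2 * (s + d + 1) - s = s + 2 * d + 1 + 1 := by omega
  rw [e1, e2, e3, e4, pow_succ]
  have hp : 1 ≤ k ^ d := Nat.one_le_pow _ _ (by omega)
  have hpk : 1 ≤ k ^ d * k := Nat.mul_pos hp (by omega)
  nlinarith [Nat.mul_le_mul_right (1 + q) hpk]

theorem KDomSeq.extend [Fintype V] [DecidableEq V] {G : SimpleGraph V} [DecidableRel G.Adj]
    {α : ℝ} {ℓ q k t : ℕ} {v : V} {s : ℕ} {vs : ℕ → V} {B : ℕ → Finset V} {u : V}
    (hs : 1 ≤ s) (hv : vs 1 = v) (hinj : ∀ i j, 1 ≤ i → i < j → j ≤ s → vs i ≠ vs j)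
    (hB1 : B 1 ⊆ G.neighborFinset (vs 1))
    (hBsub : ∀ i, 2 ≤ i → i ≤ s → B i ⊆ G.neighborFinset (vs i) ∩ B (i - 1))
    (hBcard : ∀ i, 1 ≤ i → i ≤ s → k ^ (t - i) * (2 * t - i + (t - i) * q) ≤ (B i).card)
    (hP : ∀ i, 2 ≤ i → i ≤ s → vs i ∈ PCov G α ℓ q k (vs (i - 1)))
    (hu : ∀ i, 1 ≤ i → i ≤ s → vs i ≠ u) (huP : u ∈ PCov G α ℓ q k (vs s))
    (hucard : k ^ (t - (s + 1)) * (2 * t - (s + 1) + (t - (s + 1)) * q) ≤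
      (G.neighborFinset u ∩ B s).card) :
    KDomSeq G α ℓ q k t v (s + 1) (Function.update vs (s + 1) u) := by
  have hold : ∀ i, i ≤ s → Function.update vs (s + 1) u i = vs i := fun i hi =>
    Function.update_of_ne (by omega) _ _
  have hBold : ∀ i, i ≤ s → Function.update B (s + 1) (G.neighborFinset u ∩ B s) i = B i :=
    fun i hi => Function.update_of_ne (by omega) _ _
  have hcase : ∀ i, i ≤ s + 1 → i ≤ s ∨ i = s + 1 := fun i hi => by omega
  refine ⟨by omega, by rw [hold 1 hs, hv], ?_,
    Function.update B (s + 1) (G.neighborFinset u ∩ B s), ?_, ?_, ?_, ?_⟩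
  · intro i j hi hij hj
    rcases hcase j hj with hj | rfl
    · rw [hold i (by omega), hold j hj]
      exact hinj i j hi hij hj
    · rw [hold i (by omega), Function.update_self]
      exact hu i hi (by omega)
  · rw [hold 1 hs, hBold 1 hs]
    exact hB1
  · intro i hi his
    rcases hcase i his with h | rfl
    · rw [hold i h, hBold i h, hBold (i - 1) (by omega)]
      exact hBsub i hi h
    · rw [Nat.add_sub_cancel, hBold s le_rfl, Function.update_self, Function.update_self]
  · intro i hi his
    rcases hcase i his with h | rfl
    · rw [hBold i h]
      exact hBcard i hi h
    · rwa [Function.update_self]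
  · intro i hi his
    rcases hcase i his with h | rfl
    · rw [hold i h, hold (i - 1) (by omega)]
      exact hP i hi h
    · rwa [Nat.add_sub_cancel, hold s le_rfl, Function.update_self]

/-- in a `K_{t,t}`-free graph where `D'` has the `k`-cover property
(`t ≥ 1`, `k ≥ 2`, parameters `α = 1/k`, `ℓ = 4k³+1`, `q = 4k⁴`), every maximal
`k`-dominating-sequence `(v₁, …, v_s)` of any vertex `v` satisfies `s < t` and
`{v₁, …, v_s} ∩ D' ≠ ∅`. -/
theorem stmt8 [Fintype V] [DecidableEq V] (G : SimpleGraph V) [DecidableRel G.Adj]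
    (t k : ℕ) (ht : 1 ≤ t) (hk : 2 ≤ k)
    (hKtt : ¬ HasKtt G t)
    (D' : Finset V) (hD' : KCoverProp G D' k)
    (v : V) (s : ℕ) (vs : ℕ → V)
    (hmax : MaxKDomSeq G (1 / (k : ℝ)) (4 * k ^ 3 + 1) (4 * k ^ 4) k t v s vs) :
    s < t ∧ ∃ i, 1 ≤ i ∧ i ≤ s ∧ vs i ∈ D' := by
  obtain ⟨hseq, hnot⟩ := hmax
  have hst : s < t := hseq.lt_of_not_hasKtt ht hKtt
  refine ⟨hst, ?_⟩
  by_contra! hcon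
  obtain ⟨hs, hv, hinj, B, hB1, hBsub, hBcard, hP⟩ := hseq
  obtain ⟨Z, hZD, hZk, hZcov⟩ := hD' (vs s)
  obtain ⟨L, hLZ, hL⟩ := exists_pseudoCover_of_subset_biUnion G k (4 * k ^ 3) (by omega)
    Z.card hZk Z _ rfl hZcov
  have hcover : PseudoCover G (1 / (k : ℝ)) (4 * k ^ 3 + 1) (4 * k ^ 4) k
      (G.neighborFinset (vs s)) L := by
    have hq : k * (4 * k ^ 3) = 4 * k ^ 4 := by ring
    rw [hq] at hL
    exact hL.mono_length hZk
  have hBs : B s ⊆ G.neighborFinset (vs s) := by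
    rcases Nat.lt_or_ge 1 s with h | h
    · exact (hBsub s h le_rfl).trans Finset.inter_subset_left
    · obtain rfl : s = 1 := by omega
      exact hB1
  have hbound := (kDomSeq_extend_bound (q := 4 * k ^ 4) hk hst).trans_le (hBcard s hs le_rfl)
  obtain ⟨u, huL, hucard⟩ := exists_mem_card_le_neighborFinset_inter G hcover.1
    ((Finset.card_le_card (Finset.sdiff_subset_sdiff hBs le_rfl)).trans hcover.2.1) hbound
  have huD : u ∈ D' := Finset.mem_of_mem_erase (hZD (hLZ u huL))
  have hlarge : 4 * k ^ 3 + 1 < (G.neighborFinset (vs s)).card := by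
    have h1 := Finset.card_le_card hBs
    have h2 : 4 * k ^ 3 + 1 ≤ 4 * k ^ 4 := by
      have : 1 ≤ k ^ 3 := Nat.one_le_pow _ _ (by omega)
      nlinarith
    omega
  exact hnot ⟨u, KDomSeq.extend hs hv hinj hB1 hBsub hBcard hP
    (fun i hi his h => hcon i hi his (h ▸ huD)) ⟨hlarge, L, hcover, huL⟩ hucard⟩
end
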